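/- Let A : ℝ^{n₁×n₂} → ℝ^m be a linear measurement operator, y ∈ ℝ^m, and α₁, α₂, β₁, β₂ > 0. Let (U_k, V_k)_{k≥0} be generated by alternating minimization of J, i.e. U_{k+1} minimizes U ↦ J(U, V_k) over ℝ^{n₁×R} and V_{k+1} minimizes V ↦ J(U_{k+1}, V) over ℝ^{n₂×R}. Then for every k ≥ 0, J(U_k, V_k) − J(U_{k+1}, V_{k+1}) ≥ α₁·‖U_k − U_{k+1}‖_F² + β₁·‖V_k − V_{k+1}‖_F². -/

import Mathlib

open MeasureTheory ProbabilityTheory Filter Matrix Pointwise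

noncomputable section

/-- Measurable space structure on matrices (entrywise product σ-algebra). -/
instance {m n α : Type*} [MeasurableSpace α] : MeasurableSpace (Matrix m n α) :=
  MeasurableSpace.pi (m := fun _ : m => MeasurableSpace.pi (m := fun _ : n => inferInstance))

/-- Frobenius inner product of two real matrices. -/
def frob {n₁ n₂ : ℕ} (A B : Matrix (Fin n₁) (Fin n₂) ℝ) : ℝ :=
  ∑ i, ∑ j, A i j * B i j

/-- Frobenius norm of a real matrix. -/
def frobNorm {n₁ n₂ : ℕ} (A : Matrix (Fin n₁) (Fin n₂) ℝ) : ℝ :=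
  Real.sqrt (∑ i, ∑ j, A i j ^ 2)

/-- Entrywise ℓ¹-norm of a real matrix. -/
def l1Norm {n₁ n₂ : ℕ} (A : Matrix (Fin n₁) (Fin n₂) ℝ) : ℝ :=
  ∑ i, ∑ j, |A i j|

/-- Euclidean (ℓ²) norm of a vector in ℝ^m. -/
def l2Norm {m : ℕ} (y : Fin m → ℝ) : ℝ :=
  Real.sqrt (∑ i, y i ^ 2)

/-- The linear measurement operator `A(Z)ᵢ = (1/√m)·⟨Aᵢ, Z⟩_F` determined by matrices `A i`. -/
def measOp {n₁ n₂ m : ℕ} (A : Fin m → Matrix (Fin n₁) (Fin n₂) ℝ)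
    (Z : Matrix (Fin n₁) (Fin n₂) ℝ) : Fin m → ℝ :=
  fun i => (1 / Real.sqrt m) * frob (A i) Z

/-- The multi-penalty functional
`J(U,V) = ‖y − A(UVᵀ)‖₂² + α₁‖U‖_F² + α₂‖U‖₁ + β₁‖V‖_F² + β₂‖V‖₁`. -/
def Jfun {n₁ n₂ m R : ℕ} (A : Fin m → Matrix (Fin n₁) (Fin n₂) ℝ) (y : Fin m → ℝ)
    (α₁ α₂ β₁ β₂ : ℝ) (U : Matrix (Fin n₁) (Fin R) ℝ) (V : Matrix (Fin n₂) (Fin R) ℝ) : ℝ :=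
  l2Norm (fun i => y i - measOp A (U * Vᵀ) i) ^ 2 + α₁ * frobNorm U ^ 2 + α₂ * l1Norm U
    + β₁ * frobNorm V ^ 2 + β₂ * l1Norm V

/-- The signal set `K_{s₁,s₂}^R` of matrices `Z = UVᵀ` with
`max{‖U‖_F², ‖V‖_F²} ≤ R`, `‖U‖₁ ≤ R√s₁`, `‖V‖₁ ≤ R√s₂`. -/
def Kset (n₁ n₂ : ℕ) (R : ℕ) (s₁ s₂ : ℝ) : Set (Matrix (Fin n₁) (Fin n₂) ℝ) :=
  {Z | ∃ (U : Matrix (Fin n₁) (Fin R) ℝ) (V : Matrix (Fin n₂) (Fin R) ℝ),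
    Z = U * Vᵀ ∧ max (frobNorm U ^ 2) (frobNorm V ^ 2) ≤ (R : ℝ) ∧
    l1Norm U ≤ (R : ℝ) * Real.sqrt s₁ ∧ l1Norm V ≤ (R : ℝ) * Real.sqrt s₂}

theorem frobNorm_sq {n₁ n₂ : ℕ} (W : Matrix (Fin n₁) (Fin n₂) ℝ) :
    frobNorm W ^ 2 = ∑ i, ∑ j, W i j ^ 2 :=
  Real.sq_sqrt (Finset.sum_nonneg fun _ _ => Finset.sum_nonneg fun _ _ => sq_nonneg _)

theorem l2Norm_sq {m : ℕ} (y : Fin m → ℝ) : l2Norm y ^ 2 = ∑ i, y i ^ 2 :=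
  Real.sq_sqrt (Finset.sum_nonneg fun _ _ => sq_nonneg _)

theorem frobNorm_sq_convex_comb {n₁ n₂ : ℕ} (X W : Matrix (Fin n₁) (Fin n₂) ℝ) (t : ℝ) :
    frobNorm ((1 - t) • X + t • W) ^ 2 =
      (1 - t) * frobNorm X ^ 2 + t * frobNorm W ^ 2 - t * (1 - t) * frobNorm (W - X) ^ 2 := by
  simp only [frobNorm_sq, Finset.mul_sum, ← Finset.sum_add_distrib, ← Finset.sum_sub_distrib]
  refine Finset.sum_congr rfl fun i _ => Finset.sum_congr rfl fun j _ => ?_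
  simp only [Matrix.add_apply, Matrix.sub_apply, Matrix.smul_apply, smul_eq_mul]
  ring

theorem l1Norm_convex_comb_le {n₁ n₂ : ℕ} (X W : Matrix (Fin n₁) (Fin n₂) ℝ) {t : ℝ}
    (ht₀ : 0 ≤ t) (ht₁ : t ≤ 1) :
    l1Norm ((1 - t) • X + t • W) ≤ (1 - t) * l1Norm X + t * l1Norm W := by
  simp only [l1Norm, Finset.mul_sum, ← Finset.sum_add_distrib]
  refine Finset.sum_le_sum fun i _ => Finset.sum_le_sum fun j _ => ?_
  simp only [Matrix.add_apply, Matrix.smul_apply, smul_eq_mul]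
  refine (abs_add_le _ _).trans_eq ?_
  rw [abs_mul, abs_mul, abs_of_nonneg ht₀, abs_of_nonneg (sub_nonneg.2 ht₁)]

theorem l2Norm_sq_convex_comb_le {m : ℕ} (x w : Fin m → ℝ) {t : ℝ}
    (ht₀ : 0 ≤ t) (ht₁ : t ≤ 1) :
    l2Norm ((1 - t) • x + t • w) ^ 2 ≤ (1 - t) * l2Norm x ^ 2 + t * l2Norm w ^ 2 := by
  simp only [l2Norm_sq, Finset.mul_sum, ← Finset.sum_add_distrib]
  refine Finset.sum_le_sum fun i _ => ?_
  simp only [Pi.add_apply, Pi.smul_apply, smul_eq_mul]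
  nlinarith [mul_nonneg (mul_nonneg ht₀ (sub_nonneg.2 ht₁)) (sq_nonneg (x i - w i))]

/-- Quadratic growth of an elastic-net least-squares functional at a minimizer. -/
theorem elasticNet_quadratic_growth {p q m : ℕ}
    (L : Matrix (Fin p) (Fin q) ℝ →ₗ[ℝ] (Fin m → ℝ)) (y : Fin m → ℝ) (a : ℝ) {b : ℝ}
    (hb : 0 ≤ b) (X : Matrix (Fin p) (Fin q) ℝ)
    (hX : ∀ W, l2Norm (y - L X) ^ 2 + a * frobNorm X ^ 2 + b * l1Norm X ≤
      l2Norm (y - L W) ^ 2 + a * frobNorm W ^ 2 + b * l1Norm W)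
    (W : Matrix (Fin p) (Fin q) ℝ) :
    a * frobNorm (W - X) ^ 2 ≤
      (l2Norm (y - L W) ^ 2 + a * frobNorm W ^ 2 + b * l1Norm W) -
        (l2Norm (y - L X) ^ 2 + a * frobNorm X ^ 2 + b * l1Norm X) := by
  set D := (l2Norm (y - L W) ^ 2 + a * frobNorm W ^ 2 + b * l1Norm W) -
    (l2Norm (y - L X) ^ 2 + a * frobNorm X ^ 2 + b * l1Norm X) with hD
  set c := a * frobNorm (W - X) ^ 2 with hc
  have key : ∀ t ∈ Set.Ioo (0 : ℝ) 1, (1 - t) * c ≤ D := by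
    rintro t ⟨ht₀, ht₁⟩
    have hmin := hX ((1 - t) • X + t • W)
    have hres : y - L ((1 - t) • X + t • W) = (1 - t) • (y - L X) + t • (y - L W) := by
      rw [map_add, map_smul, map_smul]
      module
    rw [hres, frobNorm_sq_convex_comb] at hmin
    have h2 := l2Norm_sq_convex_comb_le (y - L X) (y - L W) ht₀.le ht₁.le
    have h1 := mul_le_mul_of_nonneg_left (l1Norm_convex_comb_le X W ht₀.le ht₁.le) hb
    refine le_of_mul_le_mul_left ?_ ht₀
    rw [hc, hD]
    linarith
  have hlim : Tendsto (fun t : ℝ => (1 - t) * c) (nhdsWithin 0 (Set.Ioi 0)) (nhds c) := by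
    have hcont : Continuous fun t : ℝ => (1 - t) * c := by fun_prop
    simpa using (hcont.tendsto 0).mono_left nhdsWithin_le_nhds
  refine le_of_tendsto hlim ?_
  filter_upwards [Ioo_mem_nhdsGT (zero_lt_one' ℝ)] with t ht using key t ht

/-- The measurement operator as a linear map. -/
def measOpLin {n₁ n₂ m : ℕ} (A : Fin m → Matrix (Fin n₁) (Fin n₂) ℝ) :
    Matrix (Fin n₁) (Fin n₂) ℝ →ₗ[ℝ] (Fin m → ℝ) where
  toFun := measOp A
  map_add' X W := by
    funext i
    simp [measOp, frob, mul_add, Finset.sum_add_distrib]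
  map_smul' c X := by
    funext i
    simp only [measOp, frob, Matrix.smul_apply, smul_eq_mul, RingHom.id_apply, Pi.smul_apply,
      Finset.mul_sum]
    exact Finset.sum_congr rfl fun _ _ => Finset.sum_congr rfl fun _ _ => by ring

theorem Jfun_eq {n₁ n₂ m R : ℕ} (A : Fin m → Matrix (Fin n₁) (Fin n₂) ℝ) (y : Fin m → ℝ)
    (α₁ α₂ β₁ β₂ : ℝ) (U : Matrix (Fin n₁) (Fin R) ℝ) (V : Matrix (Fin n₂) (Fin R) ℝ) :
    Jfun A y α₁ α₂ β₁ β₂ U V = l2Norm (y - measOpLin A (U * Vᵀ)) ^ 2 + α₁ * frobNorm U ^ 2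
      + α₂ * l1Norm U + β₁ * frobNorm V ^ 2 + β₂ * l1Norm V :=
  rfl

/-- sufficient decrease of alternating minimization. -/
theorem alternating_minimization_decrease {n₁ n₂ m R : ℕ}
    (A : Fin m → Matrix (Fin n₁) (Fin n₂) ℝ) (y : Fin m → ℝ)
    (α₁ α₂ β₁ β₂ : ℝ) (hα₁ : 0 < α₁) (hα₂ : 0 < α₂) (hβ₁ : 0 < β₁) (hβ₂ : 0 < β₂)
    (U : ℕ → Matrix (Fin n₁) (Fin R) ℝ) (V : ℕ → Matrix (Fin n₂) (Fin R) ℝ)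
    (hU : ∀ k, ∀ U' : Matrix (Fin n₁) (Fin R) ℝ,
      Jfun A y α₁ α₂ β₁ β₂ (U (k + 1)) (V k) ≤ Jfun A y α₁ α₂ β₁ β₂ U' (V k))
    (hV : ∀ k, ∀ V' : Matrix (Fin n₂) (Fin R) ℝ,
      Jfun A y α₁ α₂ β₁ β₂ (U (k + 1)) (V (k + 1)) ≤ Jfun A y α₁ α₂ β₁ β₂ (U (k + 1)) V') :
    ∀ k, α₁ * frobNorm (U k - U (k + 1)) ^ 2 + β₁ * frobNorm (V k - V (k + 1)) ^ 2 ≤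
      Jfun A y α₁ α₂ β₁ β₂ (U k) (V k) - Jfun A y α₁ α₂ β₁ β₂ (U (k + 1)) (V (k + 1)) := by
  intro k
  let LU : Matrix (Fin n₁) (Fin R) ℝ →ₗ[ℝ] (Fin m → ℝ) :=
    measOpLin A ∘ₗ
      { toFun := fun W => W * (V k)ᵀ
        map_add' := fun X W => Matrix.add_mul X W _
        map_smul' := fun c X => Matrix.smul_mul c X _ }
  let LV : Matrix (Fin n₂) (Fin R) ℝ →ₗ[ℝ] (Fin m → ℝ) :=
    measOpLin A ∘ₗ
      { toFun := fun W => U (k + 1) * Wᵀ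
        map_add' := fun X W => by rw [Matrix.transpose_add, Matrix.mul_add]
        map_smul' := fun c X => by rw [Matrix.transpose_smul, Matrix.mul_smul, RingHom.id_apply] }
  have hLU : ∀ W, LU W = measOpLin A (W * (V k)ᵀ) := fun _ => rfl
  have hLV : ∀ W, LV W = measOpLin A (U (k + 1) * Wᵀ) := fun _ => rfl
  have hdU := elasticNet_quadratic_growth LU y α₁ hα₂.le (U (k + 1)) (fun W => by
    have h := hU k W
    rw [Jfun_eq, Jfun_eq] at h
    rw [hLU, hLU]
    linarith) (U k)
  have hdV := elasticNet_quadratic_growth LV y β₁ hβ₂.le (V (k + 1)) (fun W => by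
    have h := hV k W
    rw [Jfun_eq, Jfun_eq] at h
    rw [hLV, hLV]
    linarith) (V k)
  rw [hLU, hLU] at hdU
  rw [hLV, hLV] at hdV
  rw [Jfun_eq, Jfun_eq]
  linarith
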